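/- Fix t ∈ (0,1/4). Suppose l,p ≥ 1 are both odd and β₋,β₊ ∈ (π/2)ℤ, or l,p are both even and β₋,β₊ ∈ (π/4)ℤ, with β₋ < 0 < β₊, and suppose α ∈ (π/2)ℤ with β₋ < α < β₊. Then, with δ = 2(β₊ − β₋), W^{(α,(β₋,β₊))}_{l,p}(t) = Σ_{n∈ℤ} ( W^{(α+nδ)}_{l,p}(t) − W^{(2β₊−α+nδ)}_{l,p}(t) ), the two-sided sum converging absolutely. -/

import Mathlib

open Complex Real Set

noncomputable section

/-- A lattice point `(x,y)` viewed as the complex number `x + iy`. -/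
def ptC (p : ℤ × ℤ) : ℂ := (p.1 : ℂ) + (p.2 : ℂ) * Complex.I

/-- A diagonal step on `ℤ²`. -/
def IsDiagStep (a b : ℤ × ℤ) : Prop :=
  b - a = (1, 1) ∨ b - a = (1, -1) ∨ b - a = (-1, -1) ∨ b - a = (-1, 1)

/-- A rectilinear step on `ℤ²`. -/
def IsRectStep (a b : ℤ × ℤ) : Prop :=
  b - a = (1, 0) ∨ b - a = (-1, 0) ∨ b - a = (0, 1) ∨ b - a = (0, -1)

/-- `w` encodes a simple diagonal walk `(w₀, …, w_n)` as a list of length `n+1`. -/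
def IsWalkList (w : List (ℤ × ℤ)) : Prop := w ≠ [] ∧ w.Chain' IsDiagStep

/-- Winding angle of the walk `w` around the origin up to time `i`. -/
def windTo (w : List (ℤ × ℤ)) (i : ℕ) : ℝ :=
  ∑ j ∈ Finset.range i, (ptC (w.getD (j + 1) 0) / ptC (w.getD j 0)).arg

/-- The full winding angle of the walk `w` around the origin. -/
def wind (w : List (ℤ × ℤ)) : ℝ := windTo w (w.length - 1)

/-- The condition on walks counted by `W^{(α,I)}_{l,p}`: a simple diagonal walk on
`ℤ² ∖ {0}` from `(p,0)` to a point on one of the axes at distance `l` from the origin,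
with full winding angle `α` and intermediate winding angles in `I`. -/
def WCond (l p : ℕ) (α : ℝ) (I : Set ℝ) (w : List (ℤ × ℤ)) : Prop :=
  IsWalkList w ∧ (∀ x ∈ w, x ≠ (0, 0)) ∧ w.head? = some ((p : ℤ), 0) ∧
    (w.getLast? = some ((l : ℤ), 0) ∨ w.getLast? = some (-(l : ℤ), 0) ∨
      w.getLast? = some (0, (l : ℤ)) ∨ w.getLast? = some (0, -(l : ℤ))) ∧
    wind w = α ∧ (∀ i, 1 ≤ i → i ≤ w.length - 2 → windTo w i ∈ I)

/-- The generating function `W^{(α,I)}_{l,p}(t)`. -/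
def Wgen (t : ℝ) (l p : ℕ) (α : ℝ) (I : Set ℝ) : ℝ :=
  ∑' w : {w : List (ℤ × ℤ) // WCond l p α I w}, t ^ (w.val.length - 1)

/-- The complete elliptic integral of the first kind `K(k)`. -/
def Kell (k : ℝ) : ℝ := ∫ y in (0:ℝ)..1, 1 / Real.sqrt ((1 - y ^ 2) * (1 - k ^ 2 * y ^ 2))

/-- The complete elliptic integral of the second kind `E(k)`. -/
def Eell (k : ℝ) : ℝ := ∫ y in (0:ℝ)..1, Real.sqrt (1 - k ^ 2 * y ^ 2) / Real.sqrt (1 - y ^ 2)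

/-- The complementary modulus `k' = √(1-k²)`. -/
def kComp (k : ℝ) : ℝ := Real.sqrt (1 - k ^ 2)

/-- The elliptic nome `q_k = exp(-π K(k')/K(k))`. -/
def qNome (k : ℝ) : ℝ := Real.exp (-π * Kell (kComp k) / Kell k)

/-- The descending Landen transformation `k₁ = (1-k')/(1+k')`. -/
def kLanden (k : ℝ) : ℝ := (1 - kComp k) / (1 + kComp k)

/-- `T_k = K(k')/(4K(k))`. -/
def Tell (k : ℝ) : ℝ := Kell (kComp k) / (4 * Kell k)

/-- The plane minus the two real slits `{z ∈ ℝ : z² ≥ κ}`. -/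
def slitDom (κ : ℝ) : Set ℂ := {z : ℂ | ¬(z.im = 0 ∧ κ ≤ z.re ^ 2)}

/-- `v` is the analytic function `v_κ` on `ℂ ∖ {z ∈ ℝ : z² ≥ κ}` with `v 0 = 0` and
`v'(z) = 1/(4K(κ)√((κ-z²)(1-κz²)))`, the branch of the square root being positive on
`(-√κ, √κ)` (by analytic continuation this determines `v` uniquely). -/
structure IsVmap (κ : ℝ) (v : ℂ → ℂ) : Prop where
  map_zero : v 0 = 0
  analytic : AnalyticOnNhd ℂ v (slitDom κ)
  deriv_real : ∀ x : ℝ, x ^ 2 < κ →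
    HasDerivAt v ((1 / (4 * Kell κ * Real.sqrt ((κ - x ^ 2) * (1 - κ * x ^ 2))) : ℝ) : ℂ)
      (x : ℂ)

/-- The function `f_m(z) = cos(2πm(v(z) + 1/4)) - cos(πm/2)` built from `v = v_{k₁}`. -/
def fmFun (v : ℂ → ℂ) (m : ℕ) (z : ℂ) : ℂ :=
  Complex.cos (2 * (π : ℂ) * m * (v z + 1 / 4)) - Complex.cos ((π : ℂ) * m / 2)

/-- `a n m` is the (real) Taylor coefficient `[zⁿ] f_m(z)` at `0`. -/
def IsCoeff (κ : ℝ) (v : ℂ → ℂ) (a : ℕ → ℕ → ℝ) : Prop :=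
  ∀ m : ℕ, 1 ≤ m → ∀ z : ℂ, z ∈ slitDom κ → ‖z‖ < 1 →
    HasSum (fun n : ℕ => (a n m : ℂ) * z ^ n) (fmFun v m z)

/-- An excursion: a nonempty simple diagonal walk from the origin to the origin with no
intermediate visits to the origin. -/
def IsExcursion (w : List (ℤ × ℤ)) : Prop :=
  2 ≤ w.length ∧ w.Chain' IsDiagStep ∧ w.head? = some (0, 0) ∧ w.getLast? = some (0, 0) ∧
    ∀ i, 1 ≤ i → i ≤ w.length - 2 → w.getD i 0 ≠ (0, 0)

/-- The winding angle sequence of an excursion: `θ₀ = θ₁ = 0`, increments of the first and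
last step do not contribute, and `θ_n = θ_{n-1}`. -/
def windExcTo (w : List (ℤ × ℤ)) (i : ℕ) : ℝ :=
  ∑ j ∈ Finset.Icc 2 (min i (w.length - 2)), (ptC (w.getD j 0) / ptC (w.getD (j - 1) 0)).arg

/-- The full winding angle of an excursion. -/
def windExc (w : List (ℤ × ℤ)) : ℝ := windExcTo w (w.length - 1)

/-- `F^{(α)}(t)`: generating function of excursions with winding angle `α`. -/
def Fgen (t α : ℝ) : ℝ :=
  ∑' w : {w : List (ℤ × ℤ) // IsExcursion w ∧ windExc w = α}, t ^ (w.val.length - 1)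

/-- `F(t,b) = Σ_w t^{|w|} e^{i b θ^w}`, the characteristic function of excursions. -/
def Fchar (t b : ℝ) : ℂ :=
  ∑' w : {w : List (ℤ × ℤ) // IsExcursion w},
    (t : ℂ) ^ (w.val.length - 1) * Complex.exp (Complex.I * b * windExc w.val)

/-- `ψ_k(z) = (1 - √(1-kz²))/(√k z)` (principal square root), `ψ_k(0) = 0`. -/
def psiK (k : ℝ) (z : ℂ) : ℂ :=
  if z = 0 then 0 else (1 - (1 - (k : ℂ) * z ^ 2) ^ ((1 : ℂ) / 2)) / ((Real.sqrt k : ℂ) * z)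

/-- `a` lies on one of the coordinate axes at distance `l` from the origin. -/
def IsAxisPt (l : ℕ) (a : ℤ × ℤ) : Prop :=
  a = ((l : ℤ), 0) ∨ a = (-(l : ℤ), 0) ∨ a = (0, (l : ℤ)) ∨ a = (0, -(l : ℤ))

open Classical in
/-- The nonzero diagonal neighbours of `a`. -/
def nbrs (a : ℤ × ℤ) : Finset (ℤ × ℤ) :=
  ({a + (1, 1), a + (1, -1), a + (-1, -1), a + (-1, 1)} : Finset (ℤ × ℤ)).filter (· ≠ (0, 0))

/-- The increment of the winding angle along the step from `a` to `b`. -/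
def turn (a b : ℤ × ℤ) : ℝ := (ptC b / ptC a).arg

open Classical in
/-- The `n`-step walks from `a`, the angle being `φ` at the start and `θ` at the end, that end on
an axis at distance `l` and along which the angle always satisfies `P`. -/
def walks (P : ℝ → Prop) (l : ℕ) (θ : ℝ) : ℕ → ℤ × ℤ → ℝ → Finset (List (ℤ × ℤ))
  | 0, a, φ => if IsAxisPt l a ∧ φ = θ ∧ P φ then {[a]} else ∅
  | n + 1, a, φ => if P φ then
      (nbrs a).biUnion fun b => (walks P l θ n b (φ + turn a b)).image (List.cons a) else ∅

open Classical in
/-- The number of elements of `walks P l θ n a φ`. -/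
def walkCount (P : ℝ → Prop) (l : ℕ) (θ : ℝ) : ℕ → ℤ × ℤ → ℝ → ℝ
  | 0, a, φ => if IsAxisPt l a ∧ φ = θ ∧ P φ then 1 else 0
  | n + 1, a, φ => if P φ then ∑ b ∈ nbrs a, walkCount P l θ n b (φ + turn a b) else 0

lemma mem_nbrs {a b : ℤ × ℤ} : b ∈ nbrs a ↔ IsDiagStep a b ∧ b ≠ (0, 0) := by
  simp only [nbrs, IsDiagStep, Finset.mem_filter, Finset.mem_insert, Finset.mem_singleton,
    sub_eq_iff_eq_add, add_comm a]

lemma card_nbrs_le (a : ℤ × ℤ) : (nbrs a).card ≤ 4 :=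
  (Finset.card_filter_le _ _).trans Finset.card_le_four

lemma windTo_cons_succ (a b : ℤ × ℤ) (v : List (ℤ × ℤ)) (i : ℕ) :
    windTo (a :: b :: v) (i + 1) = turn a b + windTo (b :: v) i := by
  simp [windTo, Finset.sum_range_succ', turn, add_comm]

lemma windTo_zero (w : List (ℤ × ℤ)) : windTo w 0 = 0 := by simp [windTo]

lemma mem_walks (P : ℝ → Prop) (l : ℕ) (θ : ℝ) (n : ℕ) (a : ℤ × ℤ) (φ : ℝ) (ha : a ≠ (0, 0))
    (w : List (ℤ × ℤ)) :
    w ∈ walks P l θ n a φ ↔ ∃ v, w = a :: v ∧ v.length = n ∧ List.Chain' IsDiagStep (a :: v) ∧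
      (∀ x ∈ a :: v, x ≠ (0, 0)) ∧ (∃ e, (a :: v).getLast? = some e ∧ IsAxisPt l e) ∧
      φ + windTo (a :: v) n = θ ∧ ∀ i ≤ n, P (φ + windTo (a :: v) i) := by
  induction n generalizing a φ w with
  | zero =>
    simp only [walks]
    constructor
    · intro h
      split_ifs at h with hc
      · rw [Finset.mem_singleton] at h
        subst h
        refine ⟨[], rfl, rfl, List.isChain_singleton _, by simpa using ha, ⟨a, by simp, hc.1⟩, ?_, ?_⟩
        · simp [windTo_zero, hc.2.1]
        · intro i hi
          obtain rfl : i = 0 := by omega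
          simpa [windTo_zero] using hc.2.2
      · simp at h
    · rintro ⟨v, rfl, hv, -, -, ⟨e, he, hE⟩, hw, hP⟩
      obtain rfl := List.length_eq_zero_iff.1 hv
      simp only [List.getLast?_singleton, Option.some.injEq] at he
      subst he
      have := hP 0 le_rfl
      simp only [windTo_zero, add_zero] at this hw
      rw [if_pos ⟨hE, hw, this⟩]
      simp
  | succ n ih =>
    simp only [walks]
    constructor
    · intro h
      split_ifs at h with hc
      · simp only [Finset.mem_biUnion, Finset.mem_image] at h
        obtain ⟨b, hb, u, hu, rfl⟩ := h
        rw [mem_nbrs] at hb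
        rw [ih b _ hb.2] at hu
        obtain ⟨v, rfl, hv, hch, hne, ⟨e, he, hE⟩, hw, hP⟩ := hu
        refine ⟨b :: v, rfl, by simp [hv], List.isChain_cons_cons.2 ⟨hb.1, hch⟩, ?_,
          ⟨e, by simpa using he, hE⟩, ?_, ?_⟩
        · intro x hx
          rcases List.mem_cons.1 hx with rfl | hx
          · exact ha
          · exact hne x hx
        · rw [windTo_cons_succ, ← hw]; ring
        · intro i hi
          cases i with
          | zero => simpa [windTo_zero] using hc
          | succ i =>
            rw [windTo_cons_succ, ← add_assoc]
            exact hP i (by omega)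
      · simp at h
    · rintro ⟨v, rfl, hv, hch, hne, ⟨e, he, hE⟩, hw, hP⟩
      have h0 := hP 0 (Nat.zero_le _)
      simp only [windTo_zero, add_zero] at h0
      rw [if_pos h0]
      obtain ⟨b, v, rfl⟩ := List.exists_cons_of_length_eq_add_one hv
      obtain ⟨hab, hch⟩ := List.isChain_cons_cons.1 hch
      have hb : b ≠ (0, 0) := hne b (by simp)
      simp only [Finset.mem_biUnion, Finset.mem_image]
      refine ⟨b, mem_nbrs.2 ⟨hab, hb⟩, b :: v, ?_, rfl⟩
      rw [ih b _ hb]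
      refine ⟨v, rfl, by simpa using hv, hch, fun x hx => hne x (List.mem_cons_of_mem _ hx),
        ⟨e, by simpa using he, hE⟩, ?_, ?_⟩
      · rw [windTo_cons_succ] at hw
        rw [← hw]; ring
      · intro i hi
        have := hP (i + 1) (by omega)
        rwa [windTo_cons_succ, ← add_assoc] at this

lemma card_walks (P : ℝ → Prop) (l : ℕ) (θ : ℝ) (n : ℕ) (a : ℤ × ℤ) (φ : ℝ) :
    ((walks P l θ n a φ).card : ℝ) = walkCount P l θ n a φ := by
  classical
  induction n generalizing a φ with
  | zero => simp only [walks, walkCount]; split_ifs <;> simp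
  | succ n ih =>
    simp only [walks, walkCount]
    split_ifs
    · rw [Finset.card_biUnion]
      · push_cast
        refine Finset.sum_congr rfl fun b hb => ?_
        rw [Finset.card_image_of_injective _ (List.cons_injective), ih]
      · intro b hb c hc hbc
        rw [Function.onFun, Finset.disjoint_left]
        intro w hw hw'
        simp only [Finset.mem_image] at hw hw'
        obtain ⟨u, hu, rfl⟩ := hw
        obtain ⟨u', hu', h⟩ := hw'
        obtain rfl : u' = u := by simpa using h
        rw [mem_walks _ _ _ _ _ _ (mem_nbrs.1 hb).2] at hu
        rw [mem_walks _ _ _ _ _ _ (mem_nbrs.1 hc).2] at hu'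
        obtain ⟨v, rfl, -⟩ := hu
        obtain ⟨v', h', -⟩ := hu'
        exact hbc (List.cons.inj h').1
    · simp

lemma walkCount_nonneg (P : ℝ → Prop) (l : ℕ) (θ : ℝ) (n : ℕ) (a : ℤ × ℤ) (φ : ℝ) :
    0 ≤ walkCount P l θ n a φ := by
  rw [← card_walks]; positivity

lemma sum_walkCount_le {ι : Type*} (P : ℝ → Prop) (l : ℕ) {f : ι → ℝ} (hf : Function.Injective f)
    (s : Finset ι) (n : ℕ) (a : ℤ × ℤ) (φ : ℝ) :
    ∑ k ∈ s, walkCount P l (f k) n a φ ≤ 4 ^ n := by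
  classical
  induction n generalizing a φ with
  | zero =>
    simp only [walkCount, pow_zero]
    rw [Finset.sum_boole]
    have : (s.filter fun k => IsAxisPt l a ∧ φ = f k ∧ P φ).card ≤ 1 := by
      rw [Finset.card_le_one]
      intro i hi j hj
      simp only [Finset.mem_filter] at hi hj
      exact hf (hi.2.2.1.symm.trans hj.2.2.1)
    exact_mod_cast this
  | succ n ih =>
    simp only [walkCount]
    split_ifs
    · rw [Finset.sum_comm]
      calc _ ≤ ∑ b ∈ nbrs a, (4 : ℝ) ^ n := Finset.sum_le_sum fun b _ => ih b _
        _ = (nbrs a).card * 4 ^ n := by simp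
        _ ≤ 4 * 4 ^ n := by
          gcongr
          exact_mod_cast card_nbrs_le a
        _ = 4 ^ (n + 1) := by ring
    · simp

lemma summable_walkCount {ι : Type*} (P : ℝ → Prop) (l : ℕ) {f : ι → ℝ}
    (hf : Function.Injective f) (n : ℕ) (a : ℤ × ℤ) (φ : ℝ) :
    Summable fun k => walkCount P l (f k) n a φ :=
  summable_of_sum_le (fun _ => walkCount_nonneg _ _ _ _ _ _)
    fun s => sum_walkCount_le P l hf s n a φ

lemma walkCount_le (P : ℝ → Prop) (l : ℕ) (θ : ℝ) (n : ℕ) (a : ℤ × ℤ) (φ : ℝ) :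
    walkCount P l θ n a φ ≤ 4 ^ n := by
  simpa using sum_walkCount_le P l (f := fun _ : Unit => θ) (fun _ _ _ => rfl) {()} n a φ

lemma ptC_eq (a : ℤ × ℤ) : ptC a = ⟨a.1, a.2⟩ := by
  apply Complex.ext <;> simp [ptC]

lemma ptC_ne_zero {a : ℤ × ℤ} (ha : a ≠ (0, 0)) : ptC a ≠ 0 := by
  intro h
  simp only [ptC_eq, Complex.ext_iff, Complex.zero_re, Complex.zero_im] at h
  apply ha
  ext
  · exact_mod_cast h.1
  · exact_mod_cast h.2

lemma ptC_injective : Function.Injective ptC := by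
  intro a b h
  simp only [ptC_eq, Complex.ext_iff] at h
  ext
  · exact_mod_cast h.1
  · exact_mod_cast h.2

lemma turn_lt_pi {a b : ℤ × ℤ} (ha : a ≠ (0, 0)) (hab : IsDiagStep a b) : turn a b < π := by
  refine lt_of_le_of_ne (Complex.arg_le_pi _) fun h => ?_
  rw [turn, Complex.arg_eq_pi_iff] at h
  have ha' := ptC_ne_zero ha
  set q := (ptC b / ptC a).re with hq
  have hb : ptC b = (q : ℂ) * ptC a := by
    rw [← div_eq_iff ha']
    apply Complex.ext <;> simp [h.2, hq]
  rw [ptC_eq, ptC_eq, Complex.ext_iff] at hb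
  obtain ⟨x, y⟩ := a
  obtain ⟨x', y'⟩ := b
  simp only [Complex.mul_re, Complex.mul_im, Complex.ofReal_re, Complex.ofReal_im, zero_mul,
    sub_zero, add_zero] at hb
  have key : ∀ z z' : ℤ, (z' : ℝ) = q * z → (z' - z = 1 ∨ z' - z = -1) → z = 0 := by
    intro z z' h1 h2
    have h3 : z * z' ≤ 0 := by
      have : (z : ℝ) * z' ≤ 0 := by rw [h1]; nlinarith [h.1, sq_nonneg (z : ℝ)]
      exact_mod_cast this
    have h4 : z = 0 ∨ z' = 0 := by
      rcases h2 with h2 | h2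
      · obtain rfl : z' = z + 1 := by omega
        by_contra! hc
        rcases lt_or_gt_of_ne hc.1 with h | h
        · have : z + 1 < 0 := by omega
          nlinarith
        · nlinarith
      · obtain rfl : z' = z - 1 := by omega
        by_contra! hc
        rcases lt_or_gt_of_ne hc.1 with h | h
        · nlinarith
        · have : 0 < z - 1 := by omega
          nlinarith
    rcases h4 with h4 | h4
    · exact h4
    · rw [h4, Int.cast_zero, eq_comm, mul_eq_zero] at h1
      exact_mod_cast h1.resolve_left h.1.ne
  simp only [IsDiagStep, Prod.mk_sub_mk, Prod.mk.injEq] at hab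
  apply ha
  rw [key x x' (by simpa using hb.1) (by omega), key y y' (by simpa using hb.2) (by omega)]

lemma exp_wall (j : ℤ) :
    (Even j → cexp ((2 * (π / 4 * j) : ℝ) * I) = 1 ∨ cexp ((2 * (π / 4 * j) : ℝ) * I) = -1) ∧
    (¬ Even j → cexp ((2 * (π / 4 * j) : ℝ) * I) = I ∨ cexp ((2 * (π / 4 * j) : ℝ) * I) = -I) := by
  have hI : cexp ((2 * (π / 4 * j) : ℝ) * I) = I ^ j := by
    have h : cexp (π / 2 * I) = I := Complex.exp_pi_div_two_mul_I
    conv_rhs => rw [← h, ← Complex.exp_int_mul]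
    congr 1
    push_cast
    ring
  rw [hI]
  have hsq : (I : ℂ) ^ (2 : ℤ) = -1 := by simp
  have hneg : ∀ m : ℤ, (-1 : ℂ) ^ m = 1 ∨ (-1 : ℂ) ^ m = -1 := fun m => by
    rcases Int.even_or_odd m with h | h
    · exact Or.inl h.neg_one_zpow
    · exact Or.inr h.neg_one_zpow
  constructor
  · rintro ⟨m, rfl⟩
    rw [← two_mul, zpow_mul, hsq]
    exact hneg m
  · intro h
    obtain ⟨m, rfl⟩ := Int.not_even_iff_odd.1 h
    rw [zpow_add₀ Complex.I_ne_zero, zpow_mul, hsq, zpow_one]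
    rcases hneg m with h | h <;> simp [h]

/-- The line at angle `β` through the origin is a symmetry axis of the lattice that diagonal walks
through `a` cannot jump over. -/
def IsWall (β : ℝ) (a : ℤ × ℤ) : Prop :=
  ∃ j : ℤ, β = π / 4 * j ∧ (Even j ∨ Even (a.1 + a.2))

lemma IsWall.step {β : ℝ} {a b : ℤ × ℤ} (h : IsWall β a) (hab : IsDiagStep a b) : IsWall β b := by
  obtain ⟨j, hj, h⟩ := h
  refine ⟨j, hj, h.imp_right fun h => ?_⟩
  obtain ⟨x, y⟩ := a
  obtain ⟨x', y'⟩ := b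
  simp only [IsDiagStep, Prod.mk_sub_mk, Prod.mk.injEq] at hab
  simp only [Int.even_iff] at h ⊢
  omega

/-- Reflection in the line at angle `β`, as a map of the lattice. -/
lemma IsWall.exists_reflection {β : ℝ} {a : ℤ × ℤ} (h : IsWall β a) :
    ∃ R : ℤ × ℤ → ℤ × ℤ, (∀ x, R (R x) = x) ∧ (∀ x y, IsDiagStep x y → IsDiagStep (R x) (R y)) ∧
      (∀ l x, IsAxisPt l x → IsAxisPt l (R x)) ∧ R (0, 0) = (0, 0) ∧
      ∀ x, ptC (R x) = cexp ((2 * β : ℝ) * I) * (starRingEnd ℂ) (ptC x) := by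
  obtain ⟨j, rfl, -⟩ := h
  have hex := exp_wall j
  have hcases := (em (Even j)).imp hex.1 hex.2
  rcases hcases with (h | h) | (h | h)
  · refine ⟨fun x => (x.1, -x.2), ?_, ?_, ?_, by simp, fun x => ?_⟩
    · simp
    · rintro ⟨x, y⟩ ⟨x', y'⟩
      simp only [IsDiagStep, Prod.mk_sub_mk, Prod.mk.injEq]
      omega
    · rintro l ⟨x, y⟩
      simp only [IsAxisPt, Prod.mk.injEq]
      omega
    · rw [h, ptC_eq, ptC_eq]
      apply Complex.ext <;> simp
  · refine ⟨fun x => (-x.1, x.2), ?_, ?_, ?_, by simp, fun x => ?_⟩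
    · simp
    · rintro ⟨x, y⟩ ⟨x', y'⟩
      simp only [IsDiagStep, Prod.mk_sub_mk, Prod.mk.injEq]
      omega
    · rintro l ⟨x, y⟩
      simp only [IsAxisPt, Prod.mk.injEq]
      omega
    · rw [h, ptC_eq, ptC_eq]
      apply Complex.ext <;> simp
  · refine ⟨fun x => (x.2, x.1), ?_, ?_, ?_, by simp, fun x => ?_⟩
    · simp
    · rintro ⟨x, y⟩ ⟨x', y'⟩
      simp only [IsDiagStep, Prod.mk_sub_mk, Prod.mk.injEq]
      omega
    · rintro l ⟨x, y⟩
      simp only [IsAxisPt, Prod.mk.injEq]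
      omega
    · rw [h, ptC_eq, ptC_eq]
      apply Complex.ext <;> simp
  · refine ⟨fun x => (-x.2, -x.1), ?_, ?_, ?_, by simp, fun x => ?_⟩
    · simp
    · rintro ⟨x, y⟩ ⟨x', y'⟩
      simp only [IsDiagStep, Prod.mk_sub_mk, Prod.mk.injEq]
      omega
    · rintro l ⟨x, y⟩
      simp only [IsAxisPt, Prod.mk.injEq]
      omega
    · rw [h, ptC_eq, ptC_eq]
      apply Complex.ext <;> simp

/-- `φ` is a determination of the argument of `a`. -/
def IsAngle (a : ℤ × ℤ) (φ : ℝ) : Prop := ∃ r : ℝ, 0 < r ∧ ptC a = r * cexp (φ * I)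

lemma IsAngle.step {a b : ℤ × ℤ} {φ : ℝ} (h : IsAngle a φ) (hb : b ≠ (0, 0)) :
    IsAngle b (φ + turn a b) := by
  obtain ⟨r, hr, h⟩ := h
  have ha : ptC a ≠ 0 := by
    rw [h]
    exact mul_ne_zero (by exact_mod_cast hr.ne') (Complex.exp_ne_zero _)
  have hq := norm_pos_iff.2 (div_ne_zero (ptC_ne_zero hb) ha)
  refine ⟨r * ‖ptC b / ptC a‖, mul_pos hr hq, ?_⟩
  have h1 : ptC b = ptC a * (ptC b / ptC a) := by field_simp
  have h2 := Complex.norm_mul_exp_arg_mul_I (ptC b / ptC a)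
  rw [turn]
  generalize ptC b / ptC a = q at *
  rw [h1, ← h2, h, h2]
  push_cast
  rw [add_mul, Complex.exp_add]
  linear_combination (-(r : ℂ) * cexp (φ * I)) * h2

/-- A step moves from one side of a wall at most onto the wall. -/
lemma IsWall.sin_mul_sin_nonneg {β φ ψ : ℝ} {a b : ℤ × ℤ} (hw : IsWall β a)
    (hab : IsDiagStep a b) (ha : IsAngle a φ) (hb : IsAngle b ψ) :
    0 ≤ Real.sin (φ - β) * Real.sin (ψ - β) := by
  obtain ⟨r, hr, har⟩ := ha
  obtain ⟨s, hs, hbs⟩ := hb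
  have hwb := hw.step hab
  have e1 : ptC a * (starRingEnd ℂ) (ptC b) = (r * s : ℝ) * cexp ((φ - ψ : ℝ) * I) := by
    rw [har, hbs, map_mul, Complex.conj_ofReal, ← Complex.exp_conj, map_mul, Complex.conj_ofReal,
      Complex.conj_I]
    have : cexp ((φ - ψ : ℝ) * I) = cexp (φ * I) * cexp (ψ * -I) := by
      rw [← Complex.exp_add]; congr 1; push_cast; ring
    rw [this]; push_cast; ring
  have e2 : ptC a * ptC b * (starRingEnd ℂ) (cexp ((2 * β : ℝ) * I)) =
      (r * s : ℝ) * cexp ((φ + ψ - 2 * β : ℝ) * I) := by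
    rw [har, hbs, ← Complex.exp_conj, map_mul, Complex.conj_ofReal, Complex.conj_I]
    have : cexp ((φ + ψ - 2 * β : ℝ) * I) =
        cexp (φ * I) * cexp (ψ * I) * cexp ((2 * β : ℝ) * -I) := by
      rw [← Complex.exp_add, ← Complex.exp_add]; congr 1; push_cast; ring
    rw [this]; push_cast; ring
  have r1 := congrArg Complex.re e1
  have r2 := congrArg Complex.re e2
  rw [Complex.re_ofReal_mul, Complex.exp_ofReal_mul_I_re] at r1 r2
  have hprod : 2 * (r * s) * (Real.sin (φ - β) * Real.sin (ψ - β)) =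
      r * s * Real.cos (φ - ψ) - r * s * Real.cos (φ + ψ - 2 * β) := by
    have h1 : φ - ψ = (φ - β) - (ψ - β) := by ring
    have h2 : φ + ψ - 2 * β = (φ - β) + (ψ - β) := by ring
    rw [h1, h2, Real.cos_sub (φ - β), Real.cos_add (φ - β)]; ring
  rw [← r1, ← r2] at hprod
  have hrs : 0 < 2 * (r * s) := by positivity
  refine nonneg_of_mul_nonneg_right (b := _) (a := 2 * (r * s)) ?_ hrs
  rw [hprod]
  clear hprod r1 r2 e1 e2 har hbs
  obtain ⟨j, rfl, hj⟩ := hw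
  have hex := exp_wall j
  obtain ⟨x, y⟩ := a
  obtain ⟨x', y'⟩ := b
  simp only [IsDiagStep, Prod.mk_sub_mk, Prod.mk.injEq] at hab
  have key1 : ∀ z z' : ℤ, (z' - z = 1 ∨ z' - z = -1) → (0 : ℝ) ≤ z * z' := by
    intro z z' h
    suffices 0 ≤ z * z' by exact_mod_cast this
    rcases lt_trichotomy z 0 with hz | rfl | hz
    · exact mul_nonneg_of_nonpos_of_nonpos hz.le (by omega)
    · simp
    · exact mul_nonneg hz.le (by omega)
  have key2 : ∀ z z' : ℤ, z % 2 = 0 → (z' - z = 2 ∨ z' - z = -2 ∨ z' - z = 0) →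
      (0 : ℝ) ≤ z * z' := by
    intro z z' h2 h
    suffices 0 ≤ z * z' by exact_mod_cast this
    rcases lt_trichotomy z 0 with hz | rfl | hz
    · exact mul_nonneg_of_nonpos_of_nonpos hz.le (by omega)
    · simp
    · exact mul_nonneg hz.le (by omega)
  by_cases hev : Even j
  · rcases hex.1 hev with h | h
    · have := key1 y y' (by omega)
      rw [h, ptC_eq, ptC_eq]
      simp
      nlinarith
    · have := key1 x x' (by omega)
      rw [h, ptC_eq, ptC_eq]
      simp
      nlinarith
  · have hxy := hj.resolve_left hev
    simp only [Int.even_iff] at hxy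
    rcases hex.2 hev with h | h
    · have := key2 (x - y) (x' - y') (by omega) (by omega)
      push_cast at this
      rw [h, ptC_eq, ptC_eq]
      simp
      nlinarith
    · have := key2 (x + y) (x' + y') (by omega) (by omega)
      push_cast at this
      rw [h, ptC_eq, ptC_eq]
      simp
      nlinarith

lemma IsWall.le_of_lt {β φ : ℝ} {a b : ℤ × ℤ} (hw : IsWall β a) (hab : IsDiagStep a b)
    (ha0 : a ≠ (0, 0)) (hb0 : b ≠ (0, 0)) (ha : IsAngle a φ) (h : φ < β) :
    φ + turn a b ≤ β := by
  by_contra! hc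
  have ht := turn_lt_pi ha0 hab
  have h1 := hw.sin_mul_sin_nonneg hab ha (ha.step hb0)
  have h2 : Real.sin (φ - β) < 0 := Real.sin_neg_of_neg_of_neg_pi_lt (by linarith) (by linarith)
  have h3 : 0 < Real.sin (φ + turn a b - β) :=
    Real.sin_pos_of_pos_of_lt_pi (by linarith) (by linarith)
  nlinarith

lemma IsWall.ge_of_gt {β φ : ℝ} {a b : ℤ × ℤ} (hw : IsWall β a) (hab : IsDiagStep a b)
    (hb0 : b ≠ (0, 0)) (ha : IsAngle a φ) (h : β < φ) :
    β ≤ φ + turn a b := by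
  by_contra! hc
  have ht : -π < turn a b := Complex.neg_pi_lt_arg _
  have h1 := hw.sin_mul_sin_nonneg hab ha (ha.step hb0)
  have h2 : 0 < Real.sin (φ - β) := Real.sin_pos_of_pos_of_lt_pi (by linarith) (by linarith)
  have h3 : Real.sin (φ + turn a b - β) < 0 :=
    Real.sin_neg_of_neg_of_neg_pi_lt (by linarith) (by linarith)
  nlinarith

lemma walkCount_reflect {β : ℝ} {R : ℤ × ℤ → ℤ × ℤ} (hinv : ∀ x, R (R x) = x)
    (hstep : ∀ x y, IsDiagStep x y → IsDiagStep (R x) (R y))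
    {l : ℕ} (haxis : ∀ x, IsAxisPt l x → IsAxisPt l (R x)) (hzero : R (0, 0) = (0, 0))
    (hpt : ∀ x, ptC (R x) = cexp ((2 * β : ℝ) * I) * (starRingEnd ℂ) (ptC x))
    (θ : ℝ) (n : ℕ) (a : ℤ × ℤ) (φ : ℝ) (ha : a ≠ (0, 0)) :
    walkCount (fun _ => True) l (2 * β - θ) n (R a) (2 * β - φ) =
      walkCount (fun _ => True) l θ n a φ := by
  have hne : ∀ x, x ≠ (0, 0) → R x ≠ (0, 0) := fun x hx h => hx (by rw [← hinv x, h, hzero])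
  induction n generalizing a φ with
  | zero =>
    have h1 : IsAxisPt l (R a) ↔ IsAxisPt l a :=
      ⟨fun h => by simpa [hinv] using haxis _ h, haxis a⟩
    have h2 : 2 * β - φ = 2 * β - θ ↔ φ = θ := sub_right_inj
    simp only [walkCount]
    split_ifs with h h' h'
    · rfl
    · exact absurd ⟨h1.1 h.1, h2.1 h.2.1, trivial⟩ h'
    · exact absurd ⟨h1.2 h'.1, h2.2 h'.2.1, trivial⟩ h
    · rfl
  | succ n ih =>
    simp only [walkCount, if_true]
    refine (Finset.sum_nbij' R R ?_ ?_ (fun x _ => hinv x) (fun x _ => hinv x) ?_).symm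
    · intro b hb
      rw [mem_nbrs] at hb ⊢
      exact ⟨hstep _ _ hb.1, hne _ hb.2⟩
    · intro b hb
      rw [mem_nbrs] at hb ⊢
      exact ⟨by simpa [hinv] using hstep _ _ hb.1, hne _ hb.2⟩
    · intro b hb
      rw [mem_nbrs] at hb
      have hturn : turn (R a) (R b) = -turn a b := by
        rw [turn, hpt, hpt, mul_div_mul_left _ _ (Complex.exp_ne_zero _), ← map_div₀,
          Complex.arg_conj]
        exact if_neg (turn_lt_pi ha hb.1).ne
      rw [← ih b _ hb.2, hturn, sub_add_eq_sub_sub, sub_eq_add_neg _ (turn a b)]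

/-- Walks starting on a wall can be reflected in it. -/
lemma IsWall.walkCount_symm {β : ℝ} {a : ℤ × ℤ} (hw : IsWall β a) (hang : IsAngle a β)
    (ha : a ≠ (0, 0)) (l n : ℕ) (θ : ℝ) :
    walkCount (fun _ => True) l (2 * β - θ) n a β = walkCount (fun _ => True) l θ n a β := by
  obtain ⟨R, hinv, hstep, haxis, hzero, hpt⟩ := hw.exists_reflection
  have hfix : R a = a := by
    apply ptC_injective
    obtain ⟨r, -, hr⟩ := hang
    rw [hpt, hr, map_mul, Complex.conj_ofReal, ← Complex.exp_conj, map_mul, Complex.conj_ofReal,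
      Complex.conj_I]
    have : cexp (β * I) = cexp ((2 * β : ℝ) * I) * cexp (β * -I) := by
      rw [← Complex.exp_add]; congr 1; push_cast; ring
    rw [this]
    ring
  have := walkCount_reflect hinv hstep (haxis l) hzero hpt θ n a β ha
  rwa [hfix, show 2 * β - β = β by ring] at this

/-- The alternating sum over the reflected end angles vanishes for walks starting on one of the two
walls. -/
lemma hasSum_walkCount_of_wall {βm βp α δ φ : ℝ} (hδ0 : δ ≠ 0) (hδ : δ = 2 * (βp - βm))
    (l n : ℕ) {a : ℤ × ℤ} (ha : a ≠ (0, 0)) (hang : IsAngle a φ) (hw : IsWall φ a)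
    (hφ : φ = βm ∨ φ = βp) :
    HasSum (fun k : ℤ => walkCount (fun _ => True) l (α + k * δ) n a φ -
      walkCount (fun _ => True) l (2 * βp - α + k * δ) n a φ) 0 := by
  have hinj : Function.Injective fun k : ℤ => 2 * βp - α + k * δ := fun i j h => by
    have : (i : ℝ) = j := mul_right_cancel₀ hδ0 (add_left_cancel h)
    exact_mod_cast this
  have hsum := (summable_walkCount (fun _ => True) l hinj n a φ).hasSum
  obtain ⟨c, hc⟩ : ∃ c : ℤ, 2 * φ = 2 * βp + c * δ := by
    rcases hφ with rfl | rfl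
    · exact ⟨-1, by rw [hδ]; push_cast; ring⟩
    · exact ⟨0, by simp⟩
  have h2 := ((Equiv.subLeft c).hasSum_iff.2 hsum).sub hsum
  rw [sub_self] at h2
  convert h2 using 2 with k
  congr 1
  simp only [Function.comp, Equiv.subLeft_apply]
  have hck : 2 * βp - α + ((c - k : ℤ) : ℝ) * δ = 2 * φ - (α + k * δ) := by
    rw [hc]
    push_cast
    ring
  rw [hck, hw.walkCount_symm hang ha]

/-- The reflection principle for walks of fixed length. -/
lemma hasSum_walkCount {βm βp α δ : ℝ} (hα : βm < α ∧ α < βp) (hδ : δ = 2 * (βp - βm))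
    (l n : ℕ) (a : ℤ × ℤ) (φ : ℝ) (ha : a ≠ (0, 0)) (hang : IsAngle a φ)
    (hwm : IsWall βm a) (hwp : IsWall βp a) (hφ : βm ≤ φ ∧ φ ≤ βp) :
    HasSum (fun k : ℤ => walkCount (fun _ => True) l (α + k * δ) n a φ -
        walkCount (fun _ => True) l (2 * βp - α + k * δ) n a φ)
      (walkCount (fun x => x ∈ Set.Ioo βm βp) l α n a φ) := by
  have hδpos : 0 < δ := by linarith
  induction n generalizing a φ with
  | zero =>
    by_cases hin : φ ∈ Set.Ioo βm βp
    · have hk : ∀ k : ℤ, k ≠ 0 → (1 : ℝ) ≤ k ∨ (k : ℝ) ≤ -1 := by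
        intro k hk
        rcases lt_or_gt_of_ne hk with h | h
        · exact Or.inr (by exact_mod_cast (by omega : k ≤ -1))
        · exact Or.inl (by exact_mod_cast (by omega : 1 ≤ k))
      have h1 : ∀ k : ℤ, k ≠ 0 → φ ≠ α + k * δ := by
        intro k h0 h
        rcases hk k h0 with h' | h' <;> nlinarith [hin.1, hin.2]
      have h2 : ∀ k : ℤ, φ ≠ 2 * βp - α + k * δ := by
        intro k h
        by_cases h0 : k = 0
        · subst h0
          simp only [Int.cast_zero, zero_mul, add_zero] at h
          linarith [hin.2]
        rcases hk k h0 with h' | h' <;> nlinarith [hin.1, hin.2]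
      convert hasSum_single (0 : ℤ) ?_ using 1
      · simp only [walkCount]
        rw [if_neg fun h : IsAxisPt l a ∧ φ = 2 * βp - α + (0 : ℤ) * δ ∧ True => h2 0 h.2.1,
          sub_zero]
        have h0 : α + (0 : ℤ) * δ = α := by simp
        split_ifs with h h' h'
        · rfl
        · exact absurd ⟨h.1, h.2.1.trans h0.symm, trivial⟩ h'
        · exact absurd ⟨h'.1, h'.2.1.trans h0, hin⟩ h
        · rfl
      · intro k h0
        simp [walkCount, h1 k h0, h2]
    · have hwall : φ = βm ∨ φ = βp := by
        by_contra! h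
        exact hin ⟨lt_of_le_of_ne hφ.1 h.1.symm, lt_of_le_of_ne hφ.2 h.2⟩
      have hw : IsWall φ a := by rcases hwall with rfl | rfl <;> assumption
      convert hasSum_walkCount_of_wall hδpos.ne' hδ l 0 ha hang hw hwall using 1
      simp only [walkCount]
      exact if_neg fun h => hin h.2.2
  | succ n ih =>
    by_cases hin : φ ∈ Set.Ioo βm βp
    · simp only [walkCount]
      simp only [if_true, if_pos hin, ← Finset.sum_sub_distrib]
      refine hasSum_sum fun b hb => ?_
      obtain ⟨hab, hb0⟩ := mem_nbrs.1 hb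
      exact ih b _ hb0 (hang.step hb0) (hwm.step hab) (hwp.step hab)
        ⟨hwm.ge_of_gt hab hb0 hang hin.1, hwp.le_of_lt hab ha hb0 hang hin.2⟩
    · have hwall : φ = βm ∨ φ = βp := by
        by_contra! h
        exact hin ⟨lt_of_le_of_ne hφ.1 h.1.symm, lt_of_le_of_ne hφ.2 h.2⟩
      have hw : IsWall φ a := by rcases hwall with rfl | rfl <;> assumption
      convert hasSum_walkCount_of_wall hδpos.ne' hδ l (n + 1) ha hang hw hwall using 1
      simp only [walkCount]
      exact if_neg hin

lemma mem_walks_iff_WCond {I : Set ℝ} {θ : ℝ} (h0 : (0 : ℝ) ∈ I) (hθ : θ ∈ I) (l : ℕ) {p : ℕ}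
    (hp : 1 ≤ p) (n : ℕ) (w : List (ℤ × ℤ)) :
    w ∈ walks (fun x => x ∈ I) l θ n ((p : ℤ), 0) 0 ↔ WCond l p θ I w ∧ w.length = n + 1 := by
  rw [mem_walks _ _ _ _ _ _ (by simp; omega)]
  simp only [zero_add]
  constructor
  · rintro ⟨v, rfl, hv, hch, hne, ⟨e, he, hE⟩, hw, hP⟩
    refine ⟨⟨⟨by simp, hch⟩, hne, rfl, ?_, ?_, ?_⟩, by simp [hv]⟩
    · rw [he]
      simpa [IsAxisPt] using hE
    · simpa [wind, hv] using hw
    · intro i _ hi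
      refine hP i ?_
      simp only [List.length_cons] at hi
      omega
  · rintro ⟨⟨⟨hnil, hch⟩, hne, hhead, hlast, hw, hP⟩, hlen⟩
    obtain ⟨v, rfl⟩ : ∃ v, w = ((p : ℤ), 0) :: v := by
      cases w with
      | nil => exact absurd rfl hnil
      | cons c v => exact ⟨v, by simpa using hhead⟩
    have hv : v.length = n := by simpa using hlen
    have hw' : windTo (((p : ℤ), 0) :: v) n = θ := by simpa [wind, hv] using hw
    refine ⟨v, rfl, hv, hch, hne, ?_, hw', ?_⟩
    · rcases hlast with h | h | h | h <;> exact ⟨_, h, by simp [IsAxisPt]⟩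
    · intro i hi
      rcases Nat.eq_zero_or_pos i with rfl | hi0
      · rwa [windTo_zero]
      rcases eq_or_lt_of_le hi with rfl | hi'
      · rwa [hw']
      · refine hP i hi0 ?_
        simp only [List.length_cons]
        omega

lemma hasSum_Wgen {t : ℝ} (ht : t ∈ Set.Ioo (0 : ℝ) (1 / 4)) {I : Set ℝ} {θ : ℝ}
    (h0 : (0 : ℝ) ∈ I) (hθ : θ ∈ I) (l : ℕ) {p : ℕ} (hp : 1 ≤ p) :
    HasSum (fun n => t ^ n * walkCount (fun x => x ∈ I) l θ n ((p : ℤ), 0) 0)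
      (Wgen t l p θ I) := by
  have hmem := mem_walks_iff_WCond h0 hθ l hp
  let T := Σ n, {w // w ∈ walks (fun x => x ∈ I) l θ n ((p : ℤ), 0) 0}
  let e : T → {w // WCond l p θ I w} := fun x => ⟨x.2.1, ((hmem _ _).1 x.2.2).1⟩
  have he : Function.Bijective e := by
    constructor
    · rintro ⟨n, w, hw⟩ ⟨m, w', hw'⟩ h
      obtain rfl : w = w' := congrArg Subtype.val h
      obtain rfl : n = m := by
        have h1 := ((hmem _ _).1 hw).2
        have h2 := ((hmem _ _).1 hw').2
        omega
      rfl
    · rintro ⟨w, hw⟩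
      refine ⟨⟨w.length - 1, w, (hmem _ _).2 ⟨hw, ?_⟩⟩, rfl⟩
      have := List.length_pos_iff.2 hw.1.1
      omega
  have hfib : ∀ n, HasSum (fun _ : {w // w ∈ walks (fun x => x ∈ I) l θ n ((p : ℤ), 0) 0} => t ^ n)
      (t ^ n * walkCount (fun x => x ∈ I) l θ n ((p : ℤ), 0) 0) := by
    intro n
    have := hasSum_fintype
      fun _ : {w // w ∈ walks (fun x => x ∈ I) l θ n ((p : ℤ), 0) 0} => t ^ n
    rwa [Finset.sum_const, Finset.card_univ, Fintype.card_coe, nsmul_eq_mul, mul_comm,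
      card_walks] at this
  have hsum : Summable fun x : T => t ^ x.1 := by
    rw [summable_sigma_of_nonneg fun x => pow_nonneg ht.1.le _]
    refine ⟨fun n => (hfib n).summable, ?_⟩
    simp only [(hfib _).tsum_eq]
    refine Summable.of_nonneg_of_le
      (fun n => mul_nonneg (pow_nonneg ht.1.le _) (walkCount_nonneg _ _ _ _ _ _))
      (fun n => mul_le_mul_of_nonneg_left (walkCount_le _ _ _ _ _ _) (pow_nonneg ht.1.le _)) ?_
    simp only [← mul_pow]
    exact summable_geometric_of_lt_one (by linarith [ht.1]) (by linarith [ht.2])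
  have hW : Wgen t l p θ I = ∑' x : T, t ^ x.1 := by
    rw [Wgen, ← (Equiv.ofBijective e he).tsum_eq]
    refine tsum_congr fun x => ?_
    have := ((hmem _ _).1 x.2.2).2
    simp [e, this]
  rw [hW]
  exact hsum.hasSum.sigma hfib

lemma summable_pow_mul {t : ℝ} (ht : t ∈ Set.Ioo (0 : ℝ) (1 / 4)) {ι : Type*} {c : ℕ → ι → ℝ}
    (hc : ∀ n k, 0 ≤ c n k) (hle : ∀ n (s : Finset ι), ∑ k ∈ s, c n k ≤ 4 ^ n) :
    Summable fun x : ℕ × ι => t ^ x.1 * c x.1 x.2 := by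
  have hs : ∀ n, Summable (c n) := fun n => summable_of_sum_le (hc n) (hle n)
  have hnn : 0 ≤ fun x : ℕ × ι => t ^ x.1 * c x.1 x.2 := fun x =>
    mul_nonneg (pow_nonneg ht.1.le _) (hc _ _)
  refine (summable_prod_of_nonneg hnn).2 ⟨fun n => (hs n).mul_left (t ^ n), ?_⟩
  have hgeom : Summable fun n : ℕ => t ^ n * 4 ^ n := by
    simp only [← mul_pow]
    exact summable_geometric_of_lt_one (by linarith [ht.1]) (by linarith [ht.2])
  refine hgeom.of_nonneg_of_le (fun n => tsum_nonneg fun k => mul_nonneg (pow_nonneg ht.1.le _) (hc n k)) fun n => ?_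
  dsimp only
  rw [tsum_mul_left]
  exact mul_le_mul_of_nonneg_left ((hs n).tsum_le_of_sum_le (hle n)) (pow_nonneg ht.1.le _)

lemma summable_pow_mul_walkCount {t : ℝ} (ht : t ∈ Set.Ioo (0 : ℝ) (1 / 4)) {ι : Type*}
    (P : ℝ → Prop) (l : ℕ) {f : ι → ℝ} (hf : Function.Injective f) (a : ℤ × ℤ) (φ : ℝ) :
    Summable fun x : ℕ × ι => t ^ x.1 * walkCount P l (f x.2) x.1 a φ :=
  summable_pow_mul ht (c := fun n k => walkCount P l (f k) n a φ)
    (fun _ _ => walkCount_nonneg _ _ _ _ _ _) fun n s => sum_walkCount_le P l hf s n a φ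

/-- Lemma 10 (reflection principle): suppose `l,p` both odd and `β₋,β₊ ∈ (π/2)ℤ`, or `l,p`
both even and `β₋,β₊ ∈ (π/4)ℤ`, with `β₋ < 0 < β₊`, and `α ∈ (π/2)ℤ` with `β₋ < α < β₊`.
Then with `δ = 2(β₊-β₋)`,
`W^{(α,(β₋,β₊))}_{l,p}(t) = Σ_{n∈ℤ} (W^{(α+nδ)}_{l,p}(t) - W^{(2β₊-α+nδ)}_{l,p}(t))`,
the two-sided sum converging absolutely.  (Here `W^{(α')}_{l,p}(t) = W^{(α',ℝ)}_{l,p}(t)`.) -/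
theorem statement7 (t : ℝ) (ht : t ∈ Set.Ioo (0 : ℝ) (1 / 4))
    (l p : ℕ) (hl : 1 ≤ l) (hp : 1 ≤ p)
    (βm βp : ℝ)
    (hpar : (∃ jm jp : ℤ, Odd l ∧ Odd p ∧ βm = π / 2 * jm ∧ βp = π / 2 * jp) ∨
      (∃ jm jp : ℤ, Even l ∧ Even p ∧ βm = π / 4 * jm ∧ βp = π / 4 * jp))
    (hβ : βm < 0 ∧ 0 < βp)
    (ja : ℤ) (α : ℝ) (hα : α = π / 2 * ja) (hαmem : βm < α ∧ α < βp)
    (δ : ℝ) (hδ : δ = 2 * (βp - βm)) :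
    Summable (fun n : ℤ =>
      Wgen t l p (α + n * δ) Set.univ - Wgen t l p (2 * βp - α + n * δ) Set.univ) ∧
    Wgen t l p α (Set.Ioo βm βp) =
      ∑' n : ℤ,
        (Wgen t l p (α + n * δ) Set.univ - Wgen t l p (2 * βp - α + n * δ) Set.univ) := by
  have hδ0 : δ ≠ 0 := by linarith [hβ.1, hβ.2]
  have hinj : ∀ c : ℝ, Function.Injective fun k : ℤ => c + k * δ := fun c i j h => by
    have : (i : ℝ) = j := mul_right_cancel₀ hδ0 (add_left_cancel h)
    exact_mod_cast this
  have hp0 : (((p : ℤ), 0) : ℤ × ℤ) ≠ (0, 0) := by simp; omega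
  have hang : IsAngle ((p : ℤ), 0) 0 := ⟨p, by exact_mod_cast hp, by simp [ptC]⟩
  have hwalls : IsWall βm ((p : ℤ), 0) ∧ IsWall βp ((p : ℤ), 0) := by
    rcases hpar with ⟨jm, jp, -, -, h1, h2⟩ | ⟨jm, jp, -, he, h1, h2⟩
    · exact ⟨⟨2 * jm, by rw [h1]; push_cast; ring, Or.inl (even_two_mul _)⟩,
        ⟨2 * jp, by rw [h2]; push_cast; ring, Or.inl (even_two_mul _)⟩⟩
    · have he' : Even ((p : ℤ) + 0) := by simpa using he
      exact ⟨⟨jm, h1, Or.inr he'⟩, ⟨jp, h2, Or.inr he'⟩⟩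
  have hfix := fun n => hasSum_walkCount hαmem hδ l n _ 0 hp0 hang hwalls.1 hwalls.2
    ⟨hβ.1.le, hβ.2.le⟩
  have hsum := ((summable_pow_mul_walkCount ht (fun _ => True) l (hinj α) ((p : ℤ), 0) 0).sub
    (summable_pow_mul_walkCount ht (fun _ => True) l (hinj (2 * βp - α)) ((p : ℤ), 0) 0)).hasSum
  have hrestr := hsum.prod_fiberwise fun n => by
    simpa only [mul_sub] using (hfix n).mul_left (t ^ n)
  have hval := hrestr.unique (hasSum_Wgen ht (I := Set.Ioo βm βp) hβ hαmem l hp)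
  rw [hval] at hsum
  have hfree : ∀ θ : ℝ, HasSum
      (fun n => t ^ n * walkCount (fun _ => True) l θ n ((p : ℤ), 0) 0) (Wgen t l p θ Set.univ) :=
    fun θ => hasSum_Wgen ht (Set.mem_univ _) (Set.mem_univ _) l hp
  have hmain := ((Equiv.prodComm ℤ ℕ).hasSum_iff.2 hsum).prod_fiberwise fun k =>
    (hfree (α + k * δ)).sub (hfree (2 * βp - α + k * δ))
  exact ⟨hmain.summable, hmain.tsum_eq.symm⟩

end
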